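/- If P₀ has a winning strategy σ from (s₀, c₀) in the expanded game G' for the mean-payoff objective MP(t), then there exists a finite good strategy tree T with root labelled (s₀, c₀); consequently, P₀ has a finite-memory winning strategy (namely σ_T) from (s₀, c₀) in G' for MP(t). -/

import Mathlib

namespace AvgEnergy

/-- An integer-weighted edge over a state space `α`. -/
abbrev WEdge (α : Type*) : Type _ := α × ℤ × α

/-- A finite turn-based weighted game `G = (S₀, S₁, E)`:
`S₀` and `S₁` are disjoint sets of states covering `S`, edges carry integer
weights bounded in absolute value by `W`, and every state has an outgoing edge. -/
structure Game (S : Type*) where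
  S0 : Set S
  S1 : Set S
  E : Set (WEdge S)
  W : ℕ
  disj : Disjoint S0 S1
  cover : S0 ∪ S1 = Set.univ
  wbound : ∀ e ∈ E, -(W : ℤ) ≤ e.2.1 ∧ e.2.1 ≤ (W : ℤ)
  total : ∀ s : S, ∃ w s', (s, w, s') ∈ E

variable {α : Type*}

/-- A play from `s`: an infinite sequence of consecutive edges of `E` starting at `s`. -/
def IsPlay (E : Set (WEdge α)) (s : α) (π : ℕ → WEdge α) : Prop :=
  (∀ i, π i ∈ E) ∧ (π 0).1 = s ∧ ∀ i, (π i).2.2 = (π (i + 1)).1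

/-- Energy level of the length-`n` prefix of `π`. -/
def EL (π : ℕ → WEdge α) (n : ℕ) : ℤ :=
  ∑ i ∈ Finset.range n, (π i).2.1

/-- Mean-payoff of the length-`n` prefix of `π`. -/
def MP (π : ℕ → WEdge α) (n : ℕ) : ℚ := (EL π n : ℚ) / n

/-- Average-energy of the length-`n` prefix of `π`. -/
def AE (π : ℕ → WEdge α) (n : ℕ) : ℚ :=
  (∑ i ∈ Finset.range n, (EL π (i + 1) : ℚ)) / n

/-- `limsup_{n → ∞} f n ≤ t` (ε-characterization, valid in `ℚ`). -/
def LimsupLE (f : ℕ → ℚ) (t : ℚ) : Prop :=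
  ∀ ε : ℚ, 0 < ε → ∃ N, ∀ n ≥ N, f n ≤ t + ε

/-- The state reached after following the finite prefix `ρ` from `s`. -/
def EndSt (s : α) (ρ : List (WEdge α)) : α :=
  (ρ.getLast?.map (fun e => e.2.2)).getD s

/-- `ρ` is a finite play prefix from `s` in the graph with edge set `E`. -/
def IsPrefixFrom (E : Set (WEdge α)) (s : α) (ρ : List (WEdge α)) : Prop :=
  (∀ e ∈ ρ, e ∈ E) ∧ List.Chain' (fun e f => e.2.2 = f.1) ρ ∧
    ∀ e, ρ.head? = some e → e.1 = s

/-- A strategy (of the player owning the states in `S0`) from `s`: it assigns to every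
play prefix from `s` ending in a state of `S0` a valid outgoing edge. -/
def IsStrategy (E : Set (WEdge α)) (S0 : Set α) (s : α)
    (σ : List (WEdge α) → WEdge α) : Prop :=
  ∀ ρ, IsPrefixFrom E s ρ → EndSt s ρ ∈ S0 → σ ρ ∈ E ∧ (σ ρ).1 = EndSt s ρ

/-- The length-`n` prefix of a play, as a list of edges. -/
def Pref (π : ℕ → WEdge α) (n : ℕ) : List (WEdge α) :=
  List.ofFn (fun i : Fin n => π i)

/-- `π` is an outcome of the strategy `σ` (for the player owning `S0`) from `s`. -/
def IsOutcome (E : Set (WEdge α)) (S0 : Set α) (s : α)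
    (σ : List (WEdge α) → WEdge α) (π : ℕ → WEdge α) : Prop :=
  IsPlay E s π ∧ ∀ n, EndSt s (Pref π n) ∈ S0 → π n = σ (Pref π n)

/-- Configurations of the expanded game: `⊥` is `none`. -/
abbrev Conf (S : Type*) := Option (S × ℕ)

/-- Edges of the expanded infinite-state weighted game `G'`:
`((s,c), c', (s',c'))` whenever `(s,w,s') ∈ E` and `c' = c + w ≥ 0`;
`((s,c), ⌈t⌉+1, ⊥)` whenever some `(s,w,s') ∈ E` has `c + w < 0`; and
`(⊥, ⌈t⌉+1, ⊥)`. -/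
def ExpE {S : Type*} (G : Game S) (t : ℚ) : Set (WEdge (Conf S)) :=
  {e | (∃ (s : S) (c : ℕ) (w : ℤ) (s' : S) (c' : ℕ), (s, w, s') ∈ G.E ∧ (c : ℤ) + w = (c' : ℤ) ∧
          e = (some (s, c), (c' : ℤ), some (s', c'))) ∨
       (∃ (s : S) (c : ℕ) (w : ℤ) (s' : S), (s, w, s') ∈ G.E ∧ (c : ℤ) + w < 0 ∧
          e = (some (s, c), ⌈t⌉ + 1, (none : Conf S))) ∨
       e = ((none : Conf S), ⌈t⌉ + 1, (none : Conf S))}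

/-- The configurations of the expanded game belonging to player `P₀`. -/
def ExpS0 {S : Type*} (G : Game S) : Set (Conf S) :=
  {γ | ∃ s c, s ∈ G.S0 ∧ γ = some (s, c)}

/-- The state (configuration) visited at position `n` along a play from `s`:
`γ₀ = s` and `γ_{n+1}` is the target of the `(n+1)`-st edge. -/
def StAt (s : α) (π : ℕ → WEdge α) : ℕ → α
  | 0 => s
  | n + 1 => (π n).2.2

end AvgEnergy

namespace AvgEnergy

variable {S : Type*}

/-- A finite strategy tree for the expanded game `G'` (with threshold `t`):
a finite labelled tree with at least two nodes, given by a parent function and a depth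
function, whose nodes are labelled with configurations `(s,c) ∈ S × ℕ`, such that
* every child `m` of a node `n` corresponds to an edge
  `((lab n), (lab m).2, (lab m))` of `G'`;
* every internal node labelled by a `P₀`-configuration has exactly one child;
* every internal node labelled by a `P₁`-configuration has exactly one child per
  outgoing edge of `G'` from that configuration;
* every leaf `n` has a backward edge `back n = some n'` to a strict ancestor `n'`
  carrying the same label, and `back` is defined only at leaves. -/
structure StratTree (G : Game S) (t : ℚ) where
  N : Type
  finN : Finite N
  root : N
  parent : N → N
  lab : N → S × ℕ
  back : N → Option N
  depth : N → ℕ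
  two_le : 2 ≤ Nat.card N
  parent_root : parent root = root
  depth_root : depth root = 0
  depth_parent : ∀ n, n ≠ root → depth n = depth (parent n) + 1
  reach : ∀ n, parent^[depth n] n = root
  child_edge : ∀ n m, m ≠ root → parent m = n →
    (some (lab n), ((lab m).2 : ℤ), some (lab m)) ∈ ExpE G t
  p0_child : ∀ n, (∃ m, m ≠ root ∧ parent m = n) → (lab n).1 ∈ G.S0 →
    ∃! m, m ≠ root ∧ parent m = n
  p1_child : ∀ n, (∃ m, m ≠ root ∧ parent m = n) → (lab n).1 ∈ G.S1 →
    ∀ (w : ℤ) (γ' : Conf S), (some (lab n), w, γ') ∈ ExpE G t →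
      ∃! m, (m ≠ root ∧ parent m = n) ∧ some (lab m) = γ'
  leaf_back : ∀ n, (¬ ∃ m, m ≠ root ∧ parent m = n) →
    ∃ n', back n = some n' ∧ lab n' = lab n ∧ depth n' < depth n ∧
      parent^[depth n - depth n'] n = n'
  back_leaf : ∀ n, back n ≠ none → ¬ ∃ m, m ≠ root ∧ parent m = n

variable {G : Game S} {t : ℚ}

/-- `m` is a successor of `n` in the graph `G_T`: a child of `n` if `n` is internal,
and a child of the back-target of `n` if `n` is a leaf. -/
def Succs (T : StratTree G t) (n m : T.N) : Prop :=
  ((∃ m', m' ≠ T.root ∧ T.parent m' = n) ∧ m ≠ T.root ∧ T.parent m = n) ∨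
  ((¬ ∃ m', m' ≠ T.root ∧ T.parent m' = n) ∧
    ∃ n', T.back n = some n' ∧ m ≠ T.root ∧ T.parent m = n')

/-- The token of the memory structure `G_T` is at node `n` after the play prefix `ρ`. -/
inductive Tracks (T : StratTree G t) : List (WEdge (Conf S)) → T.N → Prop
  | nil : Tracks T [] T.root
  | step {ρ : List (WEdge (Conf S))} {n m : T.N} :
      Tracks T ρ n → Succs T n m →
      Tracks T (ρ ++ [(some (T.lab n), ((T.lab m).2 : ℤ), some (T.lab m))]) m

/-- `σ` is the strategy `σ_T` induced by the strategy tree `T`: a strategy of `P₀`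
from `lab root` which, on every play prefix tracked to a node `n` with `P₀`-label,
follows a successor of `n` in `G_T`. -/
def InducedBy (T : StratTree G t) (σ : List (WEdge (Conf S)) → WEdge (Conf S)) : Prop :=
  IsStrategy (ExpE G t) (ExpS0 G) (some (T.lab T.root)) σ ∧
  ∀ ρ n, Tracks T ρ n → (T.lab n).1 ∈ G.S0 →
    ∃ m, Succs T n m ∧ σ ρ = (some (T.lab n), ((T.lab m).2 : ℤ), some (T.lab m))

/-- The strategy tree `T` is good: for every backward edge `n ⇢ n'`, the downward path
`ρ` from `n'` to `n` (of length `depth n − depth n'`), with configuration labels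
`(s_j, c_j)`, satisfies `(1/|ρ|) Σ_{j=1}^{|ρ|} c_j ≤ t`. -/
def GoodTree (T : StratTree G t) : Prop :=
  ∀ n n', T.back n = some n' →
    (∑ j ∈ Finset.range (T.depth n - T.depth n'), ((T.lab (T.parent^[j] n)).2 : ℚ)) /
      ((T.depth n - T.depth n' : ℕ) : ℚ) ≤ t

end AvgEnergy

namespace AvgEnergy

/-- If the running averages of the costs along a sequence have limit superior at most `t` and only
finitely many points cost at most `t`, then some segment joining two visits of the same point has
average cost at most `t`. -/
theorem exists_cheap_segment {X : Type*} (c : X → ℕ) (t : ℚ) (hL : {x | (c x : ℚ) ≤ t}.Finite)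
    (γ : ℕ → X)
    (h : LimsupLE (fun n => (∑ j ∈ Finset.range n, (c (γ (j + 1)) : ℚ)) / n) t) :
    ∃ i k, 0 < k ∧ γ i = γ (i + k) ∧
      ∑ m ∈ Finset.range k, (c (γ (i + k - m)) : ℚ) ≤ t * k := by
  classical
  set q : ℤ := (t.den : ℤ) with hq
  set p : ℤ := t.num with hp
  have hq0 : (0 : ℤ) < q := by rw [hq]; exact_mod_cast t.den_pos
  have hq0' : (0 : ℚ) < q := by exact_mod_cast hq0
  have htq : t * q = p := by
    rw [hq, hp]; push_cast; exact Rat.mul_den_eq_num t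
  set b : ℕ → ℤ := fun j => q * c (γ (j + 1)) - p with hb
  set B : ℕ → ℤ := fun n => ∑ j ∈ Finset.range n, b j with hB
  have hBQ : ∀ n, (B n : ℚ) = q * (∑ j ∈ Finset.range n, (c (γ (j + 1)) : ℚ) - t * n) := by
    intro n
    simp only [hB, hb]
    push_cast
    rw [Finset.sum_sub_distrib, ← Finset.mul_sum]
    simp only [Finset.sum_const, Finset.card_range, nsmul_eq_mul]
    rw [← htq]; ring
  by_contra hcon
  have hinc : ∀ i j, i < j → γ i = γ j → B i < B j := by
    intro i j hij hγ
    by_contra hle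
    push Not at hle
    obtain ⟨k, rfl⟩ := Nat.exists_eq_add_of_lt hij
    refine hcon ⟨i, k + 1, by omega, by simpa [add_assoc] using hγ, ?_⟩
    have e1 : ∑ m ∈ Finset.range (k + 1), (c (γ (i + (k + 1) - m)) : ℚ)
        = ∑ m ∈ Finset.range (k + 1), (c (γ (i + m + 1)) : ℚ) := by
      rw [← Finset.sum_range_reflect]
      refine Finset.sum_congr rfl fun m hm => ?_
      have := Finset.mem_range.1 hm
      congr 3; omega
    have e2 := hBQ (i + k + 1)
    rw [add_assoc, Finset.sum_range_add] at e2
    have e3 := hBQ i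
    have hle' : (B (i + (k + 1)) : ℚ) ≤ B i := by exact_mod_cast hle
    rw [e1]
    rw [e2, e3, mul_le_mul_iff_right₀ hq0'] at hle'
    push_cast at hle' ⊢
    linarith
  have hlow : ∃ C : ℤ, ∀ j, (c (γ j) : ℚ) ≤ t → C ≤ B j := by
    have : ∀ x, ∃ C : ℤ, ∀ j, γ j = x → C ≤ B j := by
      intro x
      by_cases hx : ∃ j, γ j = x
      · refine ⟨B (Nat.find hx), fun j hj => ?_⟩
        rcases (Nat.find_min' hx hj).eq_or_lt with he | hlt
        · rw [he]
        · exact (hinc _ _ hlt ((Nat.find_spec hx).trans hj.symm)).le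
      · exact ⟨0, fun j hj => (hx ⟨j, hj⟩).elim⟩
    choose C hC using this
    obtain ⟨D, hD⟩ := (hL.image C).bddBelow
    exact ⟨D, fun j hj => (hD ⟨γ j, hj, rfl⟩).trans (hC _ j rfl)⟩
  obtain ⟨C, hC⟩ := hlow
  set K : ℕ := hL.toFinset.card with hK
  set R : ℕ := (1 + p.natAbs) * K + 2 with hR
  have hR0 : (0 : ℚ) < R := by positivity
  obtain ⟨M, hM⟩ := h (1 / (q * R)) (by positivity)
  obtain ⟨D, hD⟩ := ((Set.finite_Iio (M + 1)).image B).bddAbove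
  have hup : ∀ u m : ℕ, m ≤ R * u → B m ≤ u + |D| := by
    intro u m hm
    rcases lt_or_ge m (M + 1) with h1 | h1
    · have := hD ⟨m, h1, rfl⟩
      have := le_abs_self D
      omega
    · have h2 := hM m (by omega)
      have hm0 : (0 : ℚ) < m := by exact_mod_cast (by omega : 0 < m)
      simp only [div_le_iff₀ hm0] at h2
      have h3 : (B m : ℚ) ≤ m / R := by
        rw [hBQ]
        calc _ ≤ (q : ℚ) * (1 / (q * R) * m) := by
              apply mul_le_mul_of_nonneg_left _ hq0'.le; linarith
          _ = m / R := by field_simp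
      have h4 : (m : ℚ) / R ≤ u := by
        rw [div_le_iff₀ hR0, mul_comm]; exact_mod_cast hm
      have h5 : B m ≤ u := by exact_mod_cast h3.trans h4
      have := abs_nonneg D
      omega
  have hcount : ∀ u : ℕ, (((Finset.range (R * u)).filter
      (fun j => (c (γ (j + 1)) : ℚ) ≤ t)).card : ℤ) ≤ K * (u + |D| + |C| + 1 + R) := by
    intro u
    have hinj : ((Finset.range (R * u)).filter (fun j => (c (γ (j + 1)) : ℚ) ≤ t)).card ≤
        (hL.toFinset ×ˢ Finset.Icc C ((u + 1 : ℕ) + |D|)).card := by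
      refine Finset.card_le_card_of_injOn (fun j => (γ (j + 1), B (j + 1))) ?_ ?_
      · intro j hj
        simp only [Finset.coe_filter, Finset.mem_range, Set.mem_ofPred_eq] at hj
        simp only [Finset.coe_product, Set.mem_prod, Finset.mem_coe, Set.Finite.mem_toFinset,
          Set.mem_ofPred_eq, Finset.mem_Icc]
        refine ⟨hj.2, hC _ hj.2, hup (u + 1) _ ?_⟩
        have : R * (u + 1) = R * u + R := by ring
        omega
      · intro i _ j _ hij
        simp only [Prod.mk.injEq] at hij
        rcases lt_trichotomy i j with hlt | heq | hlt
        · exact absurd hij.2 (hinc _ _ (by omega) hij.1).ne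
        · exact heq
        · exact absurd hij.2.symm (hinc _ _ (by omega) hij.1.symm).ne
    rw [Finset.card_product, Int.card_Icc] at hinj
    calc _ ≤ (K * (((u + 1 : ℕ) : ℤ) + |D| + 1 - C).toNat : ℤ) := by exact_mod_cast hinj
      _ ≤ _ := by
        apply mul_le_mul_of_nonneg_left _ (by positivity)
        have := neg_abs_le C
        have := abs_nonneg D
        have := abs_nonneg C
        omega
  have hbelow : ∀ n : ℕ, (n : ℤ) - (1 + p.natAbs) * ((Finset.range n).filter
      (fun j => (c (γ (j + 1)) : ℚ) ≤ t)).card ≤ B n := by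
    intro n
    rw [Finset.card_filter]
    have : (n : ℤ) = ∑ j ∈ Finset.range n, (1 : ℤ) := by simp
    rw [this]
    push_cast
    rw [Finset.mul_sum, ← Finset.sum_sub_distrib]
    refine Finset.sum_le_sum fun j _ => ?_
    have hpa := le_abs_self p
    split_ifs with hc
    · have : 0 ≤ q * c (γ (j + 1)) := by positivity
      simp only [hb]; linarith
    · push Not at hc
      have : (p : ℚ) < q * c (γ (j + 1)) := by
        rw [← htq, mul_comm]; exact mul_lt_mul_of_pos_left hc hq0'
      have : p < q * c (γ (j + 1)) := by exact_mod_cast this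
      simp only [hb]; linarith
  set u : ℕ := ((1 + |p|) * K * (|D| + |C| + 1 + R) + |D| + 1).toNat with hu
  have hu' : (u : ℤ) = (1 + |p|) * K * (|D| + |C| + 1 + R) + |D| + 1 := by
    rw [hu, Int.toNat_of_nonneg]; positivity
  have h1 := hbelow (R * u)
  have h2 := hup u (R * u) le_rfl
  have h3 := mul_le_mul_of_nonneg_left (hcount u) (by positivity : (0 : ℤ) ≤ 1 + p.natAbs)
  have hR' : (R : ℤ) = (1 + |p|) * K + 2 := by rw [hR]; push_cast; rfl
  have h4 : ((R * u : ℕ) : ℤ) = ((1 + |p|) * K + 2) * u := by rw [← hR']; push_cast; rfl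
  rw [h4] at h1
  rw [Int.natCast_natAbs] at h1 h3
  nlinarith

/-- König's lemma for finitely branching trees of lists. -/
theorem finite_of_no_branch {X : Type*} (P : List X → Prop) (htail : ∀ x l, P (x :: l) → P l)
    (hfin : ∀ l, {x | P (x :: l)}.Finite)
    (hinf : ¬ ∃ f : ℕ → List X, f 0 = [] ∧ ∀ n, P (f n) ∧ ∃ x, f (n + 1) = x :: f n) :
    {l | P l}.Finite := by
  by_contra hP
  have hsuf : ∀ l' l, P (l' ++ l) → P l := by
    intro l' l
    induction l' with
    | nil => exact id
    | cons x l' ih => exact fun h => ih (htail _ _ h)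
  let I : List X → Prop := fun l => {l' | P l' ∧ l <:+ l'}.Infinite
  have hstep : ∀ l, I l → ∃ x, I (x :: l) := by
    intro l hl
    by_contra! hno
    refine hl (((Set.finite_singleton l).union ((hfin l).biUnion
      (t := fun x => {l' | P l' ∧ (x :: l) <:+ l'}) fun x _ => Set.not_infinite.1 (hno x))).subset ?_)
    rintro _ ⟨hl', ⟨r, rfl⟩⟩
    rcases List.eq_nil_or_concat r with rfl | ⟨r, x, rfl⟩
    · left; simp
    · right
      simp only [List.concat_eq_append, List.append_assoc, List.cons_append, List.nil_append] at hl' ⊢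
      simp only [Set.mem_iUnion]
      exact ⟨x, hsuf r _ hl', hl', List.suffix_append _ _⟩
  have h0 : I [] := by
    simp only [I, List.nil_suffix, and_true]
    exact hP
  choose g hg using hstep
  let F : ℕ → {l // I l} := fun n => Nat.rec ⟨[], h0⟩ (fun _ l => ⟨g l.1 l.2 :: l.1, hg l.1 l.2⟩) n
  refine hinf ⟨fun n => (F n).1, rfl, fun n => ⟨?_, g (F n).1 (F n).2, rfl⟩⟩
  obtain ⟨_, hl', ⟨r, rfl⟩⟩ := (F n).2.nonempty
  exact hsuf r _ hl'

section Expanded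

variable {S : Type*} {G : Game S} {t : ℚ}

/-- The edge of the expanded game between two proper configurations. -/
def move (x y : S × ℕ) : WEdge (Conf S) := (some x, (y.2 : ℤ), some y)

theorem eq_move_or_eq_bot {e : WEdge (Conf S)} {x : S × ℕ} (he : e ∈ ExpE G t)
    (hx : e.1 = some x) : (∃ y, e = move x y) ∨ e = (some x, ⌈t⌉ + 1, none) := by
  rcases he with ⟨s, c, w, s', c', -, -, rfl⟩ | ⟨s, c, w, s', -, -, rfl⟩ | rfl
  · obtain rfl := Option.some.inj hx
    exact Or.inl ⟨(s', c'), rfl⟩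
  · obtain rfl := Option.some.inj hx
    exact Or.inr rfl
  · simp at hx

theorem exists_mem_ExpE (G : Game S) (t : ℚ) (x : S × ℕ) : ∃ e ∈ ExpE G t, e.1 = some x := by
  obtain ⟨w, s', h⟩ := G.total x.1
  rcases lt_or_ge ((x.2 : ℤ) + w) 0 with hw | hw
  · exact ⟨_, Or.inr (Or.inl ⟨x.1, x.2, w, s', h, hw, rfl⟩), rfl⟩
  · exact ⟨_, Or.inl ⟨x.1, x.2, w, s', ((x.2 : ℤ) + w).toNat, h, by omega, rfl⟩, rfl⟩

theorem finite_setOf_move_mem [Finite S] (x : S × ℕ) : {y | move x y ∈ ExpE G t}.Finite := by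
  refine (Set.finite_univ.prod (Set.finite_Iic (x.2 + G.W))).subset ?_
  rintro y (⟨s, c, w, s', c', hE, hw, h⟩ | ⟨s, c, w, s', -, -, h⟩ | h)
  · simp only [move, Prod.mk.injEq, Option.some.injEq] at h
    obtain ⟨rfl, -, rfl⟩ := h
    have := (G.wbound _ hE).2
    simp only [Set.mem_prod, Set.mem_univ, true_and, Set.mem_Iic] at this ⊢
    omega
  · simp [move] at h
  · simp [move] at h

theorem some_mem_ExpS0 {x : S × ℕ} : some x ∈ ExpS0 G ↔ x.1 ∈ G.S0 := by
  constructor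
  · rintro ⟨s, c, h, he⟩
    obtain rfl := Option.some.inj he
    exact h
  · exact fun h => ⟨x.1, x.2, h, rfl⟩

theorem mem_S1_of_not_mem_S0 {s : S} (h : s ∉ G.S0) : s ∈ G.S1 :=
  (G.cover.symm ▸ Set.mem_univ s : s ∈ G.S0 ∪ G.S1).resolve_left h

end Expanded

section Histories

variable {α : Type*} {E : Set (WEdge α)} {S0 : Set α} {s : α} {σ : List (WEdge α) → WEdge α}

@[simp] theorem EndSt_nil : EndSt s ([] : List (WEdge α)) = s := rfl

@[simp] theorem EndSt_concat (ρ : List (WEdge α)) (e : WEdge α) :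
    EndSt s (ρ ++ [e]) = e.2.2 := by
  simp [EndSt]

@[simp] theorem Pref_zero (π : ℕ → WEdge α) : Pref π 0 = [] := rfl

theorem Pref_succ (π : ℕ → WEdge α) (n : ℕ) : Pref π (n + 1) = Pref π n ++ [π n] := by
  simp only [Pref, List.ofFn_succ_last, Fin.val_castSucc, Fin.val_last]

theorem EL_succ (π : ℕ → WEdge α) (n : ℕ) : EL π (n + 1) = EL π n + (π n).2.1 :=
  Finset.sum_range_succ _ _

/-- Finite play prefixes from `s` consistent with the strategy `σ`. -/
def Consistent (E : Set (WEdge α)) (S0 : Set α) (s : α) (σ : List (WEdge α) → WEdge α)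
    (ρ : List (WEdge α)) : Prop :=
  ∀ ρ' e, (ρ' ++ [e]) <+: ρ → e ∈ E ∧ e.1 = EndSt s ρ' ∧ (EndSt s ρ' ∈ S0 → e = σ ρ')

theorem consistent_nil : Consistent E S0 s σ [] := by
  intro ρ' e h
  simp at h

theorem consistent_concat {ρ : List (WEdge α)} {e : WEdge α} :
    Consistent E S0 s σ (ρ ++ [e]) ↔ Consistent E S0 s σ ρ ∧
      e ∈ E ∧ e.1 = EndSt s ρ ∧ (EndSt s ρ ∈ S0 → e = σ ρ) := by
  constructor
  · exact fun h => ⟨fun ρ' e' h' => h ρ' e' (h'.trans (List.prefix_append _ _)), h ρ e List.prefix_rfl⟩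
  · rintro ⟨h, he⟩ ρ' e' h'
    rcases List.prefix_concat_iff.1 h' with heq | h'
    · obtain ⟨rfl, h2⟩ := List.append_inj' heq rfl
      obtain rfl := List.singleton_inj.1 h2
      exact he
    · exact h ρ' e' h'

theorem Consistent.isPrefixFrom {ρ : List (WEdge α)} (h : Consistent E S0 s σ ρ) :
    IsPrefixFrom E s ρ := by
  induction ρ using List.reverseRecOn with
  | nil => exact ⟨by simp, List.IsChain.nil, by simp⟩
  | append_singleton ρ e ih =>
    obtain ⟨h, he, hs, -⟩ := consistent_concat.1 h
    obtain ⟨h1, h2, h3⟩ := ih h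
    refine ⟨?_, ?_, ?_⟩
    · intro e' he'
      rcases List.mem_append.1 he' with h' | h'
      · exact h1 _ h'
      · rwa [List.mem_singleton.1 h']
    · refine List.isChain_append.2 ⟨h2, by simp, ?_⟩
      intro x hx y hy
      simp only [List.head?_cons, Option.mem_def, Option.some.injEq] at hx hy
      subst hy
      rw [hs]; simp [EndSt, hx]
    · intro e' he'
      cases ρ with
      | nil =>
        simp only [List.nil_append, List.head?_cons, Option.some.injEq] at he'
        subst he'
        simpa using hs
      | cons a ρ => exact h3 e' (by simpa using he')

theorem isOutcome_of_consistent {π : ℕ → WEdge α} (h : ∀ n, Consistent E S0 s σ (Pref π n)) :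
    IsOutcome E S0 s σ π := by
  have key : ∀ n, π n ∈ E ∧ (π n).1 = EndSt s (Pref π n) ∧
      (EndSt s (Pref π n) ∈ S0 → π n = σ (Pref π n)) := fun n => by
    have := h (n + 1)
    rw [Pref_succ, consistent_concat] at this
    exact this.2
  refine ⟨⟨fun i => (key i).1, (key 0).2.1, fun i => ?_⟩, fun n => (key n).2.2⟩
  rw [(key (i + 1)).2.1, Pref_succ, EndSt_concat]

end Histories

section Win

variable {S : Type*} {G : Game S} {t : ℚ} {γ₀ : Conf S}
  {σ : List (WEdge (Conf S)) → WEdge (Conf S)}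

/-- Histories consistent with a winning strategy do not end in `⊥`. -/
theorem Consistent.EndSt_ne_none
    (hwin : ∀ π, IsOutcome (ExpE G t) (ExpS0 G) γ₀ σ π → LimsupLE (MP π) t)
    {ρ : List (WEdge (Conf S))} (h : Consistent (ExpE G t) (ExpS0 G) γ₀ σ ρ) :
    EndSt γ₀ ρ ≠ none := by
  intro hnone
  set e : WEdge (Conf S) := (none, ⌈t⌉ + 1, none) with he
  set π : ℕ → WEdge (Conf S) := fun i => ρ[i]?.getD e with hπ
  have hloop : ∀ k, π (ρ.length + k) = e := fun k => by simp [hπ]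
  have hshort : ∀ n, n ≤ ρ.length → Pref π n = ρ.take n := by
    intro n hn
    refine List.ext_getElem (by simp [Pref, hn]) fun i h1 h2 => ?_
    have : i < ρ.length := by simp at h2; omega
    simp [Pref, hπ, this]
  have hlong : ∀ k, Consistent (ExpE G t) (ExpS0 G) γ₀ σ (Pref π (ρ.length + k)) ∧
      EndSt γ₀ (Pref π (ρ.length + k)) = none := by
    intro k
    induction k with
    | zero => rw [add_zero, hshort _ le_rfl, List.take_length]; exact ⟨h, hnone⟩
    | succ k ih =>
      rw [← add_assoc, Pref_succ, hloop, consistent_concat, EndSt_concat, ih.2]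
      exact ⟨⟨ih.1, Or.inr (Or.inr rfl), rfl, fun ⟨_, _, _, h⟩ => by simp at h⟩, rfl⟩
  have hlim := hwin π <| isOutcome_of_consistent fun n => by
    rcases le_total n ρ.length with hn | hn
    · rw [hshort n hn]
      exact fun ρ' e' h' => h ρ' e' (h'.trans (List.take_prefix _ _))
    · obtain ⟨k, rfl⟩ := Nat.exists_eq_add_of_le hn
      exact (hlong k).1
  have hEL : ∀ k, EL π (ρ.length + k) = EL π ρ.length + k * (⌈t⌉ + 1) := by
    intro k
    induction k with
    | zero => simp
    | succ k ih => rw [← add_assoc, EL_succ, ih, hloop, he]; push_cast; ring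
  obtain ⟨N, hN⟩ := hlim (1 / 2) (by norm_num)
  obtain ⟨m, hm⟩ := exists_nat_gt (2 * ((ρ.length : ℚ) * (t + 1 / 2) - EL π ρ.length))
  have h1 := hN (ρ.length + (N + m + 1)) (by omega)
  have hpos : (0 : ℚ) < ((ρ.length + (N + m + 1) : ℕ) : ℚ) := by positivity
  rw [MP, div_le_iff₀ hpos, hEL] at h1
  have h2 := Int.le_ceil t
  have h3 : (0 : ℚ) ≤ N := Nat.cast_nonneg N
  have h4 : (0 : ℚ) ≤ m := Nat.cast_nonneg m
  have h5 : ((N : ℚ) + m + 1) * t ≤ (N + m + 1) * ⌈t⌉ :=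
    mul_le_mul_of_nonneg_left h2 (by positivity)
  push_cast at h1
  linarith

end Win

section InducedStrategy

variable {S : Type*} {G : Game S} {t : ℚ} (T : StratTree G t)

/-- The total excess over `t` of the energy levels on the branch from the root to a node. -/
def StratTree.excess (n : T.N) : ℚ :=
  ∑ j ∈ Finset.range (T.depth n), (((T.lab (T.parent^[j] n)).2 : ℚ) - t)

theorem StratTree.excess_child {n m : T.N} (hm : m ≠ T.root) (hp : T.parent m = n) :
    T.excess m = T.excess n + ((T.lab m).2 - t) := by
  rw [excess, excess, T.depth_parent m hm, Finset.sum_range_succ', hp]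
  simp [Function.iterate_succ_apply, hp]

variable {T}

theorem StratTree.excess_le_of_back (hT : GoodTree T) {n n' : T.N} (hb : T.back n = some n')
    (hd : T.depth n' < T.depth n) (hit : T.parent^[T.depth n - T.depth n'] n = n') :
    T.excess n ≤ T.excess n' := by
  have hg := hT n n' hb
  obtain ⟨k, hk⟩ := Nat.exists_eq_add_of_lt hd
  have hk' : T.depth n - T.depth n' = k + 1 := by omega
  rw [hk'] at hit hg
  have hpos : (0 : ℚ) < ((k + 1 : ℕ) : ℚ) := by positivity
  rw [div_le_iff₀ hpos] at hg
  have hsplit : T.excess n = ∑ j ∈ Finset.range (k + 1),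
      (((T.lab (T.parent^[j] n)).2 : ℚ) - t) + T.excess n' := by
    rw [excess, show T.depth n = (k + 1) + T.depth n' by omega, Finset.sum_range_add, excess]
    congr 1
    refine Finset.sum_congr rfl fun j _ => ?_
    rw [add_comm (k + 1) j, Function.iterate_add_apply, hit]
  rw [hsplit, Finset.sum_sub_distrib]
  simp only [Finset.sum_const, Finset.card_range, nsmul_eq_mul]
  linarith

/-- The successors of a node in `G_T` are the children of some internal node with the same label,
whose branch has at least the same excess. -/
theorem StratTree.exists_internal (hT : GoodTree T) (n : T.N) :
    ∃ n', (∃ m, m ≠ T.root ∧ T.parent m = n') ∧ T.lab n' = T.lab n ∧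
      T.excess n ≤ T.excess n' ∧ ∀ m, Succs T n m ↔ m ≠ T.root ∧ T.parent m = n' := by
  by_cases hn : ∃ m, m ≠ T.root ∧ T.parent m = n
  · exact ⟨n, hn, rfl, le_rfl, fun m => by simp [Succs, hn]⟩
  · obtain ⟨n', hb, hl, hd, hit⟩ := T.leaf_back n hn
    refine ⟨n', ⟨T.parent^[T.depth n - T.depth n' - 1] n, ?_, ?_⟩, hl,
      excess_le_of_back hT hb hd hit, fun m => ?_⟩
    · intro hroot
      have : T.parent^[T.depth n - T.depth n' - 1 + 1] n = n' := by
        rwa [Nat.sub_add_cancel (by omega)]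
      rw [Function.iterate_succ_apply', hroot, T.parent_root] at this
      subst this
      rw [T.depth_root] at hd hroot
      have hchain : ∀ j, j ≤ T.depth n → T.depth (T.parent^[j] n) = T.depth n - j := by
        intro j
        induction j with
        | zero => simp
        | succ j ih =>
          intro hj
          have ih := ih (by omega)
          have hne : T.parent^[j] n ≠ T.root := by
            intro h
            rw [h, T.depth_root] at ih
            omega
          have := T.depth_parent _ hne
          rw [Function.iterate_succ_apply']
          omega
      have := hchain (T.depth n - 0 - 1) (by omega)
      rw [hroot, T.depth_root] at this
      omega
    · rw [← Function.iterate_succ_apply' T.parent, Nat.succ_eq_add_one,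
        Nat.sub_add_cancel (by omega), hit]
    · simp only [Succs, hn, hb, false_and, false_or, not_false_eq_true, true_and,
        Option.some.injEq, exists_eq_left']

theorem Succs.move_mem (hT : GoodTree T) {n m : T.N} (h : Succs T n m) :
    move (T.lab n) (T.lab m) ∈ ExpE G t := by
  obtain ⟨n', -, hl, -, hs⟩ := T.exists_internal hT n
  rw [← hl]
  exact T.child_edge n' m ((hs m).1 h).1 ((hs m).1 h).2

theorem Succs.eq_of_lab_eq (hT : GoodTree T) {n m m' : T.N} (h : Succs T n m) (h' : Succs T n m')
    (hl : T.lab m = T.lab m') : m = m' := by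
  obtain ⟨n', hi, hln, -, hs⟩ := T.exists_internal hT n
  have hm := (hs m).1 h
  have hm' := (hs m').1 h'
  by_cases h0 : (T.lab n').1 ∈ G.S0
  · exact (T.p0_child n' hi h0).unique hm hm'
  · exact (T.p1_child n' hi (mem_S1_of_not_mem_S0 h0) _ _ (T.child_edge n' m hm.1 hm.2)).unique
      ⟨hm, rfl⟩ ⟨hm', by rw [hl]⟩

theorem Tracks.EndSt_eq {ρ : List (WEdge (Conf S))} {n : T.N} (h : Tracks T ρ n) :
    EndSt (some (T.lab T.root)) ρ = some (T.lab n) := by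
  cases h <;> simp

theorem Tracks.unique (hT : GoodTree T) {ρ : List (WEdge (Conf S))} {n n' : T.N}
    (h : Tracks T ρ n) (h' : Tracks T ρ n') : n = n' := by
  induction h generalizing n' with
  | nil =>
    generalize hρ : ([] : List (WEdge (Conf S))) = ρ at h'
    cases h' with
    | nil => rfl
    | step _ _ => simp at hρ
  | @step ρ n m hn hs ih =>
    generalize hρ : ρ ++ [(some (T.lab n), ((T.lab m).2 : ℤ), some (T.lab m))] = ρ₁ at h'
    cases h' with
    | nil => simp at hρ
    | step hn' hs' =>
      obtain ⟨rfl, he⟩ := List.append_inj' hρ rfl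
      obtain rfl := ih hn'
      simp only [List.cons.injEq, Prod.mk.injEq, Option.some.injEq] at he
      exact hs.eq_of_lab_eq hT hs' he.1.2.2

theorem exists_inducedBy (hT : GoodTree T) : ∃ σ, InducedBy T σ := by
  classical
  have hsucc : ∀ n : T.N, ∃ m, Succs T n m := fun n => by
    obtain ⟨n', ⟨m, hm⟩, -, -, hs⟩ := T.exists_internal hT n
    exact ⟨m, (hs m).2 hm⟩
  choose next hnext using hsucc
  choose out hout hsrc using exists_mem_ExpE G t
  let σ : List (WEdge (Conf S)) → WEdge (Conf S) := fun ρ =>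
    if h : ∃ n, Tracks T ρ n then move (T.lab h.choose) (T.lab (next h.choose))
    else out ((EndSt (some (T.lab T.root)) ρ).getD (T.lab T.root))
  refine ⟨σ, fun ρ _ hend => ?_, fun ρ n hn _ => ⟨next n, hnext n, ?_⟩⟩
  · by_cases h : ∃ n, Tracks T ρ n
    · simp only [σ, dif_pos h]
      exact ⟨(hnext _).move_mem hT, h.choose_spec.EndSt_eq.symm⟩
    · obtain ⟨s, c, -, he⟩ := hend
      simp only [σ, dif_neg h, he]
      exact ⟨hout _, hsrc _⟩
  · have h : ∃ n, Tracks T ρ n := ⟨n, hn⟩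
    simp only [σ, dif_pos h]
    rw [h.choose_spec.unique hT hn]
    rfl

/-- Strategies induced by a good tree are winning. -/
theorem InducedBy.limsupLE (hT : GoodTree T) {σ : List (WEdge (Conf S)) → WEdge (Conf S)}
    (hσ : InducedBy T σ) {π : ℕ → WEdge (Conf S)}
    (hπ : IsOutcome (ExpE G t) (ExpS0 G) (some (T.lab T.root)) σ π) : LimsupLE (MP π) t := by
  have hsrc : ∀ k, (π k).1 = EndSt (some (T.lab T.root)) (Pref π k) := by
    intro k
    cases k with
    | zero => exact hπ.1.2.1
    | succ k => rw [Pref_succ, EndSt_concat, hπ.1.2.2]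
  have key : ∀ k, ∃ n, Tracks T (Pref π k) n ∧ (EL π k : ℚ) - t * k ≤ T.excess n := by
    intro k
    induction k with
    | zero => exact ⟨T.root, Tracks.nil, by simp [EL, StratTree.excess, T.depth_root]⟩
    | succ k ih =>
      obtain ⟨n, hn, hle⟩ := ih
      obtain ⟨n', hi, hl, hex, hs⟩ := T.exists_internal hT n
      have hmove : ∃ m, Succs T n m ∧ π k = move (T.lab n) (T.lab m) := by
        by_cases h0 : (T.lab n).1 ∈ G.S0
        · obtain ⟨m, hm, he⟩ := hσ.2 _ _ hn h0
          refine ⟨m, hm, ?_⟩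
          rw [hπ.2 k (by rw [hn.EndSt_eq]; exact some_mem_ExpS0.2 h0), he]
          rfl
        · have hk : (π k).1 = some (T.lab n') := by rw [hsrc, hn.EndSt_eq, hl]
          have hE := hπ.1.1 k
          obtain ⟨m, hm, -⟩ := T.p1_child n' hi (mem_S1_of_not_mem_S0 (hl ▸ h0))
            (π k).2.1 (π k).2.2 (by rw [← hk]; exact hE)
          refine ⟨m, (hs m).2 hm.1, ?_⟩
          rcases eq_move_or_eq_bot hE hk with ⟨y, hy⟩ | hy
          · rw [hy] at hm
            rw [hy, ← hl, Option.some.inj hm.2]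
          · rw [hy] at hm
            simp at hm
      obtain ⟨m, hm, he⟩ := hmove
      refine ⟨m, ?_, ?_⟩
      · rw [Pref_succ, he]
        exact hn.step hm
      · obtain ⟨hr, hp⟩ := (hs m).1 hm
        rw [EL_succ, he, T.excess_child hr hp]
        push_cast [move]
        linarith
  have := T.finN
  obtain ⟨C, hC⟩ := (Set.finite_range T.excess).bddAbove
  intro ε hε
  obtain ⟨N, hN⟩ := exists_nat_gt (C / ε)
  refine ⟨N + 1, fun k hk => ?_⟩
  obtain ⟨n, -, hle⟩ := key k
  have hk0 : (0 : ℚ) < k := by exact_mod_cast (by omega : 0 < k)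
  have hkN : (N : ℚ) ≤ k := by exact_mod_cast (by omega : N ≤ k)
  rw [MP, div_le_iff₀ hk0]
  rw [div_lt_iff₀ hε] at hN
  have hCn : T.excess n ≤ C := hC ⟨n, rfl⟩
  nlinarith

end InducedStrategy

section Unfolding

variable {S : Type} {G : Game S} {t : ℚ}

/-- The last configuration of a branch from `r`, the most recent configuration being listed
first. -/
def lastConf (r : S × ℕ) (l : List (S × ℕ)) : S × ℕ := l.headD r

@[simp] theorem lastConf_nil (r : S × ℕ) : lastConf r [] = r := rfl

@[simp] theorem lastConf_cons (r x : S × ℕ) (l : List (S × ℕ)) : lastConf r (x :: l) = x := rfl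

/-- The branch ends with a cycle of length `k` whose average energy is at most `t`. -/
def CheapCycle (t : ℚ) (r : S × ℕ) (l : List (S × ℕ)) (k : ℕ) : Prop :=
  0 < k ∧ k ≤ l.length ∧ lastConf r (l.drop k) = lastConf r l ∧
    ∑ j ∈ Finset.range k, ((lastConf r (l.drop j)).2 : ℚ) ≤ t * k

/-- The branches from `r` made of moves allowed by `A`, none of whose strict prefixes ends with a
cheap cycle. -/
def IsBranch (t : ℚ) (r : S × ℕ) (A : List (S × ℕ) → S × ℕ → Prop) : List (S × ℕ) → Prop
  | [] => True
  | x :: l => IsBranch t r A l ∧ (¬ ∃ k, CheapCycle t r l k) ∧ A l x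

theorem IsBranch.drop {r : S × ℕ} {A : List (S × ℕ) → S × ℕ → Prop} {l : List (S × ℕ)}
    (h : IsBranch t r A l) (k : ℕ) : IsBranch t r A (l.drop k) := by
  induction k generalizing l with
  | zero => simpa using h
  | succ k ih =>
    cases l with
    | nil => exact h
    | cons x l => exact ih h.1

/-- Cutting all branches at their first cheap cycle yields a good tree, provided that this leaves
finitely many branches and that the allowed moves are those of a strategy of `P₀`. -/
theorem exists_goodTree {r : S × ℕ} {A : List (S × ℕ) → S × ℕ → Prop}
    (hfin : {l | IsBranch t r A l}.Finite)
    (hmove : ∀ l x, A l x → move (lastConf r l) x ∈ ExpE G t)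
    (hP0 : ∀ l, IsBranch t r A l → (lastConf r l).1 ∈ G.S0 → ∃! x, A l x)
    (hP1 : ∀ l, IsBranch t r A l → (lastConf r l).1 ∈ G.S1 →
      ∀ w γ', (some (lastConf r l), w, γ') ∈ ExpE G t → ∃ x, A l x ∧ some x = γ') :
    ∃ T : StratTree G t, T.lab T.root = r ∧ GoodTree T := by
  classical
  let N : Type := {l : List (S × ℕ) // IsBranch t r A l}
  have finN : Finite N := hfin
  let root : N := ⟨[], trivial⟩
  let parent : N → N := fun n => ⟨n.1.tail, by simpa using n.2.drop 1⟩
  have hne : ∀ n : N, n ≠ root ↔ n.1 ≠ [] := fun n => not_congr Subtype.ext_iff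
  have hit : ∀ k (n : N), (parent^[k] n).1 = n.1.drop k := by
    intro k n
    induction k with
    | zero => rfl
    | succ k ih => rw [Function.iterate_succ_apply']; simp [parent, ih]
  have hcons : ∀ n m : N, (m ≠ root ∧ parent m = n) → ∃ x, m.1 = x :: n.1 ∧ A n.1 x ∧
      ¬ ∃ k, CheapCycle t r n.1 k := by
    rintro ⟨l, hl⟩ ⟨l', hl'⟩ ⟨h1, h2⟩
    cases l' with
    | nil => simp [hne] at h1
    | cons x l' =>
      obtain rfl : l' = l := congrArg Subtype.val h2
      exact ⟨x, rfl, hl'.2.2, hl'.2.1⟩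
  have hchild : ∀ (n : N) (h : ¬ ∃ k, CheapCycle t r n.1 k) x (hx : A n.1 x),
      (⟨x :: n.1, n.2, h, hx⟩ : N) ≠ root ∧ parent ⟨x :: n.1, n.2, h, hx⟩ = n := fun n h x hx =>
    ⟨by simp [hne], rfl⟩
  have hint : ∀ n : N, (∃ m, m ≠ root ∧ parent m = n) ↔ ¬ ∃ k, CheapCycle t r n.1 k := by
    refine fun n => ⟨fun ⟨m, hm⟩ => (hcons n m hm).choose_spec.2.2, fun h => ?_⟩
    by_cases h0 : (lastConf r n.1).1 ∈ G.S0
    · obtain ⟨x, hx, -⟩ := hP0 n.1 n.2 h0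
      exact ⟨_, hchild n h x hx⟩
    · obtain ⟨⟨a, w, γ'⟩, he, rfl⟩ := exists_mem_ExpE G t (lastConf r n.1)
      obtain ⟨x, hx, -⟩ := hP1 n.1 n.2 (mem_S1_of_not_mem_S0 h0) w γ' he
      exact ⟨_, hchild n h x hx⟩
  let T : StratTree G t :=
    { N := N
      finN := finN
      root := root
      parent := parent
      lab := fun n => lastConf r n.1
      back := fun n => if h : ∃ k, CheapCycle t r n.1 k then some (parent^[h.choose] n) else none
      depth := fun n => n.1.length
      two_le := by
        obtain ⟨m, hm, -⟩ := (hint root).2 (by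
          rintro ⟨k, h1, h2, -⟩
          simp only [root, List.length_nil] at h2
          omega)
        have : Nontrivial N := ⟨m, root, hm⟩
        exact Finite.one_lt_card
      parent_root := rfl
      depth_root := rfl
      depth_parent := fun n hn => by
        have := List.length_pos_iff.2 ((hne n).1 hn)
        simp only [parent, List.length_tail]
        omega
      reach := fun n => Subtype.ext (by rw [hit]; simp [root])
      child_edge := fun n m hm hp => by
        obtain ⟨x, hx, hA, -⟩ := hcons n m ⟨hm, hp⟩
        rw [hx]
        exact hmove _ _ hA
      p0_child := fun n hn h0 => by
        obtain ⟨x, hx, hu⟩ := hP0 n.1 n.2 h0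
        refine ⟨_, hchild n ((hint n).1 hn) x hx, fun m hm => Subtype.ext ?_⟩
        obtain ⟨y, hy, hA, -⟩ := hcons n m hm
        exact hy.trans (congrArg (· :: n.1) (hu y hA))
      p1_child := fun n hn h1 w γ' he => by
        obtain ⟨x, hx, rfl⟩ := hP1 n.1 n.2 h1 w γ' he
        refine ⟨_, ⟨hchild n ((hint n).1 hn) x hx, rfl⟩, fun m hm => Subtype.ext ?_⟩
        obtain ⟨y, hy, -, -⟩ := hcons n m hm.1
        have hyx := hm.2
        rw [hy, lastConf_cons] at hyx
        exact hy.trans (congrArg (· :: n.1) (Option.some.inj hyx))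
      leaf_back := fun n hn => by
        have h : ∃ k, CheapCycle t r n.1 k := by
          by_contra h
          exact hn ((hint n).2 h)
        obtain ⟨h1, h2, h3, -⟩ := h.choose_spec
        refine ⟨_, dif_pos h, by rw [hit]; exact h3, ?_, ?_⟩
        · rw [hit, List.length_drop]; omega
        · congr 1
          rw [hit, List.length_drop]; omega
      back_leaf := fun n hn hi => hn (dif_neg ((hint n).1 hi)) }
  refine ⟨T, rfl, fun n n' hb => ?_⟩
  by_cases h : ∃ k, CheapCycle t r n.1 k
  · have hb' : (if h : ∃ k, CheapCycle t r n.1 k then some (parent^[h.choose] n) else none)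
        = some n' := hb
    rw [dif_pos h, Option.some.injEq] at hb'
    obtain ⟨h1, h2, h3, h4⟩ := h.choose_spec
    have hd : T.depth n - T.depth n' = h.choose := by
      change n.1.length - n'.1.length = _
      rw [← hb', hit, List.length_drop]; omega
    rw [hd, div_le_iff₀ (by exact_mod_cast h1)]
    refine le_trans (le_of_eq (Finset.sum_congr rfl fun j _ => ?_)) h4
    change ((lastConf r (parent^[j] n).1).2 : ℚ) = _
    rw [hit]
  · exact absurd (hb.symm.trans (dif_neg h)) (by simp)

/-- The sequence of edges of the expanded game along a branch from `r`. -/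
def edges (r : S × ℕ) : List (S × ℕ) → List (WEdge (Conf S))
  | [] => []
  | x :: l => edges r l ++ [move (lastConf r l) x]

theorem EndSt_edges (r : S × ℕ) (l : List (S × ℕ)) :
    EndSt (some r) (edges r l) = some (lastConf r l) := by
  cases l <;> simp [edges, move]

/-- The moves consistent with the strategy `σ` after a branch from `r`. -/
def StrategyMove (G : Game S) (t : ℚ) (r : S × ℕ) (σ : List (WEdge (Conf S)) → WEdge (Conf S))
    (l : List (S × ℕ)) (x : S × ℕ) : Prop :=
  move (lastConf r l) x ∈ ExpE G t ∧
    ((lastConf r l).1 ∈ G.S0 → move (lastConf r l) x = σ (edges r l))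

theorem IsBranch.consistent {r : S × ℕ} {σ : List (WEdge (Conf S)) → WEdge (Conf S)}
    {l : List (S × ℕ)} (h : IsBranch t r (StrategyMove G t r σ) l) :
    Consistent (ExpE G t) (ExpS0 G) (some r) σ (edges r l) := by
  induction l with
  | nil => exact consistent_nil
  | cons x l ih =>
    refine consistent_concat.2 ⟨ih h.1, h.2.2.1, (EndSt_edges r l).symm, fun h0 => ?_⟩
    rw [EndSt_edges] at h0
    exact h.2.2.2 (some_mem_ExpS0.1 h0)

/-- For a winning strategy, every infinite branch ends with a cheap cycle at some point. -/
theorem finite_isBranch [Finite S] {r : S × ℕ} {σ : List (WEdge (Conf S)) → WEdge (Conf S)}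
    (hwin : ∀ π, IsOutcome (ExpE G t) (ExpS0 G) (some r) σ π → LimsupLE (MP π) t) :
    {l | IsBranch t r (StrategyMove G t r σ) l}.Finite := by
  refine finite_of_no_branch _ (fun x l h => h.1) (fun l => (finite_setOf_move_mem (G := G) (t := t)
    (lastConf r l)).subset fun x hx => hx.2.2.1) ?_
  rintro ⟨f, hf0, hf⟩
  choose hbr x hx using hf
  let γ : ℕ → S × ℕ := fun n => lastConf r (f n)
  have hγ : ∀ n, γ (n + 1) = x n := fun n => by simp [γ, hx]
  let π : ℕ → WEdge (Conf S) := fun n => move (γ n) (γ (n + 1))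
  have hπ : ∀ n, Pref π n = edges r (f n) := by
    intro n
    induction n with
    | zero => rw [hf0]; rfl
    | succ n ih => rw [Pref_succ, ih, hx, edges, ← hγ]
  have hlim := hwin π (isOutcome_of_consistent fun n => by rw [hπ]; exact (hbr n).consistent)
  have hlow : {y : S × ℕ | (y.2 : ℚ) ≤ t}.Finite := by
    refine (Set.finite_univ.prod (Set.finite_Iic ⌊t⌋₊)).subset fun y hy => ?_
    exact ⟨trivial, Nat.le_floor hy⟩
  obtain ⟨i, k, hk, hik, hsum⟩ := exists_cheap_segment (fun y : S × ℕ => y.2) t hlow γ (by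
    convert hlim using 2 with n
    simp [MP, EL, π, move])
  have hlen : ∀ n, (f n).length = n := by
    intro n
    induction n with
    | zero => simp [hf0]
    | succ n ih => rw [hx, List.length_cons, ih]
  have hdrop : ∀ j n, (f (n + j)).drop j = f n := by
    intro j
    induction j with
    | zero => simp
    | succ j ih => intro n; rw [← add_assoc, hx, List.drop_succ_cons, ih]
  have hnext := hbr (i + k + 1)
  rw [hx] at hnext
  refine hnext.2.1 ⟨k, hk, by rw [hlen]; omega, ?_, ?_⟩
  · rw [hdrop]; exact hik
  · refine le_trans (le_of_eq (Finset.sum_congr rfl fun j hj => ?_)) hsum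
    have := Finset.mem_range.1 hj
    obtain ⟨n, hn⟩ := Nat.exists_eq_add_of_le' (show j ≤ i + k by omega)
    rw [hn, hdrop, Nat.add_sub_cancel]

end Unfolding

/-- If `P₀` has a winning strategy `σ` from `(s₀, c₀)` in the expanded
game `G'` for the mean-payoff objective `MP(t)`, then there exists a finite good strategy
tree `T` with root labelled `(s₀, c₀)`; consequently, `P₀` has a finite-memory winning
strategy (namely the induced strategy `σ_T`) from `(s₀, c₀)` in `G'` for `MP(t)`. -/
theorem statement9 {S : Type} [Fintype S] (G : Game S) (t : ℚ) (s₀ : S) (c₀ : ℕ)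
    (hwin : ∃ σ, IsStrategy (ExpE G t) (ExpS0 G) (some (s₀, c₀)) σ ∧
      ∀ π, IsOutcome (ExpE G t) (ExpS0 G) (some (s₀, c₀)) σ π →
        LimsupLE (MP π) t) :
    ∃ T : StratTree G t, T.lab T.root = (s₀, c₀) ∧ GoodTree T ∧
      ∃ σT, InducedBy T σT ∧
        ∀ π, IsOutcome (ExpE G t) (ExpS0 G) (some (s₀, c₀)) σT π →
          LimsupLE (MP π) t := by
  obtain ⟨σ, hσ, hwin⟩ := hwin
  have htarget : ∀ l, IsBranch t (s₀, c₀) (StrategyMove G t (s₀, c₀) σ) l → ∀ e ∈ ExpE G t,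
      e.1 = some (lastConf (s₀, c₀) l) →
      ((lastConf (s₀, c₀) l).1 ∈ G.S0 → e = σ (edges (s₀, c₀) l)) →
      ∃ x, e = move (lastConf (s₀, c₀) l) x := by
    intro l hl e he hsrc h0
    refine (eq_move_or_eq_bot he hsrc).resolve_right fun hbot => ?_
    refine Consistent.EndSt_ne_none hwin (consistent_concat.2 ⟨hl.consistent, he,
      by rw [hsrc, EndSt_edges], fun h => h0 (some_mem_ExpS0.1 (EndSt_edges _ l ▸ h))⟩) ?_
    rw [EndSt_concat, hbot]
  obtain ⟨T, hroot, hT⟩ := exists_goodTree (G := G) (finite_isBranch hwin) (fun l x h => h.1)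
    (fun l hl h0 => by
      obtain ⟨he, hsrc⟩ := hσ _ hl.consistent.isPrefixFrom
        (by rw [EndSt_edges]; exact some_mem_ExpS0.2 h0)
      rw [EndSt_edges] at hsrc
      obtain ⟨x, hx⟩ := htarget l hl _ he hsrc fun _ => rfl
      refine ⟨x, ⟨hx ▸ he, fun _ => hx.symm⟩, fun y hy => ?_⟩
      exact Option.some.inj (congrArg (fun e => e.2.2) ((hy.2 h0).trans hx)))
    (fun l hl h1 w γ' he => by
      have h0 : (lastConf (s₀, c₀) l).1 ∉ G.S0 := fun h0 => Set.disjoint_left.1 G.disj h0 h1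
      obtain ⟨x, hx⟩ := htarget l hl _ he rfl fun h => (h0 h).elim
      exact ⟨x, ⟨hx ▸ he, fun h => (h0 h).elim⟩, (congrArg (fun e => e.2.2) hx).symm⟩)
  obtain ⟨σT, hσT⟩ := exists_inducedBy hT
  exact ⟨T, hroot, hT, σT, hσT, fun π hπ => hσT.limsupLE hT (by rw [hroot]; exact hπ)⟩

end AvgEnergy
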